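/- arXiv:1710.10706 — 3 statements merged into one kernel-verified Lean document; each statement's English description precedes it below -/
import Mathlib

section
/- Let n be a natural number, S a finite type, m : S → Set (Fin n) and b : Set S. Then the following are equivalent: (i) for every J : Finset (Fin n), the number of points s : S such that i ∈ m s for some i ∈ J is at least J.card, and the number of points s : S such that s ∉ b and i ∉ m s for all i ∈ J is at most n - J.card (truncated natural-number subtraction); (ii) there exists an injective function f : Fin n → S such that i ∈ m (f i) for every i : Fin n, and s ∈ b for every s : S outside the range of f. -/
open Classical in
/-- Hall's theorem for a relation between `ι` and `S` when, in addition, the matching has to cover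
every point outside `b`: a set `J` of indices must have at least `#J` neighbours, and at least
`#J + (#S - #ι)` points must lie in `b` or be neighbours of `J`. -/
theorem exists_injective_rel_and_compl_range_subset {ι S : Type*} [Fintype ι] [Fintype S]
    (r : ι → S → Prop) (b : Set S)
    (hall : ∀ J : Finset ι, J.card ≤ {s : S | ∃ i ∈ J, r i s}.ncard)
    (hall_union : ∀ J : Finset ι,
      J.card + (Fintype.card S - Fintype.card ι) ≤ {s : S | s ∈ b ∨ ∃ i ∈ J, r i s}.ncard) :
    ∃ f : ι → S, Function.Injective f ∧ (∀ i, r i (f i)) ∧ (Set.range f)ᶜ ⊆ b := by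
  -- Add `#S - #ι` dummy indices related to all of `b`; an injection is then a bijection onto `S`.
  let t : ι ⊕ Fin (Fintype.card S - Fintype.card ι) → Finset S :=
    Sum.elim (fun i => Finset.univ.filter (r i)) (fun _ => Finset.univ.filter (· ∈ b))
  have hcard : Fintype.card ι ≤ Fintype.card S := by
    rw [← Finset.card_univ, ← Nat.card_eq_fintype_card]
    exact (hall Finset.univ).trans (Set.ncard_le_card _)
  obtain ⟨g, hg, hgt⟩ := (Finset.all_card_le_biUnion_card_iff_exists_injective t).1 fun K => by
    rw [← Set.ncard_coe_finset (K.biUnion t), ← Finset.card_toLeft_add_card_toRight]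
    rcases K.toRight.eq_empty_or_nonempty with hK | ⟨d, hd⟩
    · rw [hK, Finset.card_empty, add_zero]
      refine (hall K.toLeft).trans (Set.ncard_le_ncard ?_)
      rintro s ⟨i, hi, his⟩
      simpa [t] using Or.inl ⟨i, by simpa using hi, his⟩
    · have hle : K.toRight.card ≤ Fintype.card S - Fintype.card ι := by
        simpa using Finset.card_le_univ K.toRight
      refine ((Nat.add_le_add_left hle _).trans (hall_union K.toLeft)).trans
        (Set.ncard_le_ncard ?_)
      rintro s (hs | ⟨i, hi, his⟩)
      · simpa [t] using Or.inr ⟨⟨d, by simpa using hd⟩, hs⟩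
      · simpa [t] using Or.inl ⟨i, by simpa using hi, his⟩
  have hbij : Function.Bijective g :=
    (Fintype.bijective_iff_injective_and_card g).2 ⟨hg, by simp; omega⟩
  refine ⟨g ∘ Sum.inl, hg.comp Sum.inl_injective, fun i => ?_, fun s hs => ?_⟩
  · simpa [t] using hgt (Sum.inl i)
  · obtain ⟨i | d, rfl⟩ := hbij.2 s
    · exact absurd ⟨i, rfl⟩ hs
    · simpa [t] using hgt (Sum.inr d)


/-- Hall-theorem combinatorial core of Proposition 3.5 (graded modal logic):
the conjunction of the formulas `χ_J` is equivalent to the disjunctive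
modality `δ⟨a₁,…,aₙ; b⟩` over Kripkean one-step models of the bag functor. -/
theorem graded_hall_equivalence (n : ℕ) (S : Type*) [Fintype S]
    (m : S → Set (Fin n)) (b : Set S) :
    (∀ J : Finset (Fin n),
        J.card ≤ {s : S | ∃ i ∈ J, i ∈ m s}.ncard ∧
        {s : S | s ∉ b ∧ ∀ i ∈ J, i ∉ m s}.ncard ≤ n - J.card) ↔
    (∃ f : Fin n → S, Function.Injective f ∧ (∀ i : Fin n, i ∈ m (f i)) ∧
        ∀ s : S, s ∉ Set.range f → s ∈ b) := by
  constructor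
  · intro h
    refine exists_injective_rel_and_compl_range_subset (fun i s => i ∈ m s) b
      (fun J => (h J).1) fun J => ?_
    have hcompl : {s : S | s ∈ b ∨ ∃ i ∈ J, i ∈ m s}ᶜ = {s : S | s ∉ b ∧ ∀ i ∈ J, i ∉ m s} := by
      ext s
      simp
    have hsum := Set.ncard_add_ncard_compl {s : S | s ∈ b ∨ ∃ i ∈ J, i ∈ m s}
    rw [hcompl, Nat.card_eq_fintype_card] at hsum
    have hJ : J.card ≤ n := by simpa using J.card_le_univ
    have huniv : n ≤ Fintype.card S := by
      simpa using (h Finset.univ).1.trans (Set.ncard_le_card _)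
    have hout := (h J).2
    rw [Fintype.card_fin]
    omega
  · rintro ⟨f, hf, hfm, hfb⟩ J
    constructor
    · rw [← Set.ncard_coe_finset J, ← Set.ncard_image_of_injective _ hf]
      refine Set.ncard_le_ncard ?_
      rintro _ ⟨i, hi, rfl⟩
      exact ⟨i, hi, hfm i⟩
    · have hJ : (Jᶜ).card = n - J.card := by rw [Finset.card_compl, Fintype.card_fin]
      rw [← hJ, ← Set.ncard_coe_finset Jᶜ, ← Set.ncard_image_of_injective _ hf]
      refine Set.ncard_le_ncard ?_
      rintro s ⟨hsb, hsJ⟩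
      obtain ⟨i, rfl⟩ : s ∈ Set.range f := by
        by_contra hs
        exact hsb (hfb s hs)
      exact ⟨i, by simpa using fun hi => hsJ i hi (hfm i), rfl⟩
end

section
/- Let S and A be types, k : ℕ, a : Fin k → A, B : Set A and m : S → Set A. Suppose there exists an injective x : Fin k → S such that a i ∈ m (x i) for all i and for every s outside the range of x there is some v ∈ B with v ∈ m s. Then there exists m' : S → Set A such that m' s ⊆ m s for all s, m' s has at most one element for all s, and there exists an injective x' : Fin k → S such that a i ∈ m' (x' i) for all i and for every s outside the range of x' there is some v ∈ B with v ∈ m' s. -/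
/-- Equation (eq:nbB1): if a Kripkean one-step model of the bag functor
satisfies `β(ā, B)`, then it can be re-marked by a pointwise smaller,
subsingleton-valued marking which still satisfies `β(ā, B)`. -/
theorem beta_dividing_marking (S A : Type*) (k : ℕ) (a : Fin k → A)
    (B : Set A) (m : S → Set A)
    (h : ∃ x : Fin k → S, Function.Injective x ∧ (∀ i : Fin k, a i ∈ m (x i)) ∧
        ∀ s : S, s ∉ Set.range x → ∃ v ∈ B, v ∈ m s) :
    ∃ m' : S → Set A, (∀ s : S, m' s ⊆ m s) ∧ (∀ s : S, (m' s).Subsingleton) ∧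
      ∃ x' : Fin k → S, Function.Injective x' ∧ (∀ i : Fin k, a i ∈ m' (x' i)) ∧
        ∀ s : S, s ∉ Set.range x' → ∃ v ∈ B, v ∈ m' s := by
  obtain ⟨x, hx, ha, hB⟩ := h
  have hf : ∀ s, ∃ v ∈ m s, (∀ i, x i = s → v = a i) ∧ (s ∉ Set.range x → v ∈ B) := by
    intro s
    by_cases hs : s ∈ Set.range x
    · obtain ⟨i, rfl⟩ := hs
      exact ⟨a i, ha i, fun j hj => by rw [hx hj], fun h => absurd ⟨i, rfl⟩ h⟩
    · obtain ⟨v, hv, hvm⟩ := hB s hs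
      exact ⟨v, hvm, fun i hi => absurd ⟨i, hi⟩ hs, fun _ => hv⟩
  choose f hfm hfa hfB using hf
  exact ⟨fun s => {f s}, fun s => Set.singleton_subset_iff.2 (hfm s),
    fun s => Set.subsingleton_singleton, x, hx, fun i => (hfa (x i) i rfl).symm,
    fun s hs => ⟨f s, hfB s hs, rfl⟩⟩
end

section
/- Let X and V be types, let Y, Z : Set X with Y finite or Z finite, let A₀, A₁ : Finset V, and let m : X → Set V. Suppose: every y ∈ Y satisfies some a ∈ A₀ (i.e., ∃ a ∈ A₀, a ∈ m y); every a ∈ A₀ is satisfied at some y ∈ Y; every z ∈ Z satisfies some a ∈ A₁; and every a ∈ A₁ is satisfied at some z ∈ Z. Then there exist a type X', sets Y', Z' : Set X' with Y' finite or Z' finite, a map f : X' → X and a marking m' : X' → Set V such that: f '' Y' = Y; f '' Z' = Z; for every u : X', m' u ⊆ m (f u) and m' u has at most one element; every point of Y' satisfies some a ∈ A₀ under m'; every a ∈ A₀ is satisfied at some point of Y' under m'; every point of Z' satisfies some a ∈ A₁ under m'; and every a ∈ A₁ is satisfied at some point of Z' under m'. -/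
universe u v

/-- The pairs `(x, a)` with `x ∈ Y` and `a ∈ A` such that `a` holds at `x` under the marking `m`. -/
def satisfyingPairs {X : Type u} {V : Type v} (m : X → Set V) (Y : Set X) (A : Finset V) :
    Set (X × V) :=
  {p | p.1 ∈ Y ∧ p.2 ∈ A ∧ p.2 ∈ m p.1}

theorem satisfyingPairs_finite {X : Type u} {V : Type v} (m : X → Set V) {Y : Set X}
    (hY : Y.Finite) (A : Finset V) : (satisfyingPairs m Y A).Finite :=
  (hY.prod A.finite_toSet).subset fun _ hp => ⟨hp.1, hp.2.1⟩

theorem image_fst_satisfyingPairs {X : Type u} {V : Type v} {m : X → Set V} {Y : Set X}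
    {A : Finset V} (h : ∀ y ∈ Y, ∃ a ∈ A, a ∈ m y) :
    Prod.fst '' satisfyingPairs m Y A = Y := by
  ext x
  constructor
  · rintro ⟨p, hp, rfl⟩
    exact hp.1
  · intro hx
    obtain ⟨a, ha, ham⟩ := h x hx
    exact ⟨(x, a), ⟨hx, ha, ham⟩, rfl⟩

/-- Section 3.3.4: the formulas `∇⁰A₀ ∧ ∇¹A₁` are disjunctive for the
functor `F X = {(Y, Z) ∈ P X × P X | Y finite or Z finite}`: every one-step
model satisfying the formula has a dividing cover still satisfying it. -/
theorem nabla_pair_disjunctive (X : Type u) (V : Type v) (Y Z : Set X)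
    (hfin : Y.Finite ∨ Z.Finite) (A₀ A₁ : Finset V) (m : X → Set V)
    (h1 : ∀ y ∈ Y, ∃ a ∈ A₀, a ∈ m y)
    (h2 : ∀ a ∈ A₀, ∃ y ∈ Y, a ∈ m y)
    (h3 : ∀ z ∈ Z, ∃ a ∈ A₁, a ∈ m z)
    (h4 : ∀ a ∈ A₁, ∃ z ∈ Z, a ∈ m z) :
    ∃ (X' : Type (max u v)) (Y' Z' : Set X') (f : X' → X) (m' : X' → Set V),
      (Y'.Finite ∨ Z'.Finite) ∧
      f '' Y' = Y ∧ f '' Z' = Z ∧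
      (∀ u : X', m' u ⊆ m (f u)) ∧ (∀ u : X', (m' u).Subsingleton) ∧
      (∀ y ∈ Y', ∃ a ∈ A₀, a ∈ m' y) ∧
      (∀ a ∈ A₀, ∃ y ∈ Y', a ∈ m' y) ∧
      (∀ z ∈ Z', ∃ a ∈ A₁, a ∈ m' z) ∧
      (∀ a ∈ A₁, ∃ z ∈ Z', a ∈ m' z) := by
  refine ⟨X × V, satisfyingPairs m Y A₀, satisfyingPairs m Z A₁, Prod.fst,
    fun p => {p.2} ∩ m p.1,
    hfin.imp (satisfyingPairs_finite m · A₀) (satisfyingPairs_finite m · A₁),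
    image_fst_satisfyingPairs h1, image_fst_satisfyingPairs h3,
    fun _ => Set.inter_subset_right,
    fun _ => Set.subsingleton_singleton.anti Set.inter_subset_left,
    fun p hp => ⟨p.2, hp.2.1, rfl, hp.2.2⟩, fun a ha => ?_,
    fun p hp => ⟨p.2, hp.2.1, rfl, hp.2.2⟩, fun a ha => ?_⟩
  · obtain ⟨y, hy, hm⟩ := h2 a ha
    exact ⟨(y, a), ⟨hy, ha, hm⟩, rfl, hm⟩
  · obtain ⟨z, hz, hm⟩ := h4 a ha
    exact ⟨(z, a), ⟨hz, ha, hm⟩, rfl, hm⟩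
end
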